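/- Let g be a simple complex Lie algebra not isomorphic to sl_n(C) for any n ≥ 3. Then the space of g-module morphisms g ⊗ g → g is one-dimensional, spanned by the Lie bracket. -/

import Mathlib

open scoped TensorProduct

/-- The space `Hom_g(g ⊗ g, g)` of `g`-module morphisms, where `g` acts on itself by
the adjoint representation and on `g ⊗ g` by derivations. -/
def homg (g : Type*) [LieRing g] [LieAlgebra ℂ g] :
    Submodule ℂ (g ⊗[ℂ] g →ₗ[ℂ] g) where
  carrier := {f | ∀ x y z : g,
    f (⁅x, y⁆ ⊗ₜ[ℂ] z + y ⊗ₜ[ℂ] ⁅x, z⁆) = ⁅x, f (y ⊗ₜ[ℂ] z)⁆}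
  add_mem' := by
    intro f₁ f₂ h₁ h₂ x y z
    simp [h₁ x y z, h₂ x y z]
  zero_mem' := by intro x y z; simp
  smul_mem' := by
    intro c f hf x y z
    simp [hf x y z]

section Realization

open Module

attribute [local instance] LieRing.ofAssociativeRing

/-- A Lie algebra which is linearly identified, compatibly with commutators, with the traceless
endomorphisms of a vector space `W` is isomorphic to `sl_n` for `n = dim W`. -/
lemma nonempty_lieEquiv_sl_of_traceless {K g W : Type*} [Field K] [LieRing g] [LieAlgebra K g]
    [AddCommGroup W] [Module K W] [FiniteDimensional K W] (φ : g →ₗ[K] End K W)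
    (hφ : ∀ x y, φ ⁅x, y⁆ = φ x * φ y - φ y * φ x) (hinj : Function.Injective φ)
    (hrange : ∀ T : End K W, T ∈ LinearMap.range φ ↔ LinearMap.trace K W T = 0) :
    Nonempty (g ≃ₗ⁅K⁆ LieAlgebra.SpecialLinear.sl (Fin (finrank K W)) K) := by
  let b := finBasis K W
  let e := LinearMap.toMatrixAlgEquiv b
  have he : ∀ T, (e T).trace = LinearMap.trace K W T := fun T ↦
    (LinearMap.trace_eq_matrix_trace K b T).symm
  let ψ : g →ₗ⁅K⁆ LieAlgebra.SpecialLinear.sl (Fin (finrank K W)) K :=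
    { toFun := fun x ↦ ⟨e (φ x), by
        change Matrix.trace (e (φ x)) = 0
        rw [he]
        exact (hrange _).1 ⟨x, rfl⟩⟩
      map_add' := fun x y ↦ by ext1; simp
      map_smul' := fun c x ↦ by ext1; simp
      map_lie' := fun {x y} ↦ by
        ext1
        rw [LieAlgebra.SpecialLinear.sl_bracket]
        simp [hφ] }
  refine ⟨LieEquiv.ofBijective ψ ⟨fun x y h ↦ hinj (e.injective (congrArg Subtype.val h)), ?_⟩⟩
  rintro ⟨M, hM⟩
  obtain ⟨x, hx⟩ := (hrange (e.symm M)).2 (by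
    rw [← he, AlgEquiv.apply_symm_apply]
    exact hM)
  refine ⟨x, Subtype.ext ?_⟩
  change e (φ x) = M
  rw [hx, AlgEquiv.apply_symm_apply]

end Realization

section ProjectiveAction

open Module

variable {K g : Type*} [Field K] [LieRing g] [LieAlgebra K g]

/-- The eigenspace of `ad ω` for the eigenvalue one. -/
def gradeOne (K : Type*) {g : Type*} [Field K] [LieRing g] [LieAlgebra K g] (ω : g) :
    Submodule K g :=
  LinearMap.ker (LieAlgebra.ad K g ω - LinearMap.id : g →ₗ[K] g)

lemma mem_gradeOne {ω x : g} : x ∈ gradeOne K ω ↔ ⁅ω, x⁆ = x := by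
  simp [gradeOne, sub_eq_zero]

/-- The projection of `g` onto the eigenspace of `ad ω` for the eigenvalue one, when
`(ad ω) ^ 3 = ad ω`. -/
def gradeOneProj (ω : g) (hω : ∀ x : g, ⁅ω, ⁅ω, ⁅ω, x⁆⁆⁆ = ⁅ω, x⁆) : g →ₗ[K] gradeOne K ω :=
  LinearMap.codRestrict (gradeOne K ω)
    ((2⁻¹ : K) • (LieAlgebra.ad K g ω ∘ₗ LieAlgebra.ad K g ω + LieAlgebra.ad K g ω))
    fun x ↦ by
      rw [mem_gradeOne]
      simp [hω, add_comm]

lemma coe_gradeOneProj (ω : g) (hω : ∀ x : g, ⁅ω, ⁅ω, ⁅ω, x⁆⁆⁆ = ⁅ω, x⁆) (x : g) :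
    (gradeOneProj (K := K) ω hω x : g) = (2⁻¹ : K) • (⁅ω, ⁅ω, x⁆⁆ + ⁅ω, x⁆) := by
  simp [gradeOneProj]

/-- Every element is a sum of eigenvectors of `ad ω` when `(ad ω) ^ 3 = ad ω`. -/
lemma exists_graded_decomposition (K : Type*) [Field K] [CharZero K] [LieAlgebra K g] {ω : g}
    (hω : ∀ x : g, ⁅ω, ⁅ω, ⁅ω, x⁆⁆⁆ = ⁅ω, x⁆) (x : g) :
    ∃ a b d : g, ⁅ω, a⁆ = a ∧ ⁅ω, b⁆ = 0 ∧ ⁅ω, d⁆ = -d ∧ x = a + b + d := by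
  refine ⟨(2⁻¹ : K) • (⁅ω, ⁅ω, x⁆⁆ + ⁅ω, x⁆), x - ⁅ω, ⁅ω, x⁆⁆,
    (2⁻¹ : K) • (⁅ω, ⁅ω, x⁆⁆ - ⁅ω, x⁆), ?_, ?_, ?_, ?_⟩
  · simp [hω, add_comm]
  · simp [hω]
  · simp [hω, ← smul_neg]
  · module

variable (ω : g) (B : LinearMap.BilinForm K g) (hω : ∀ x : g, ⁅ω, ⁅ω, ⁅ω, x⁆⁆⁆ = ⁅ω, x⁆)

/-- The linear map underlying the action of `g = g₋₁ ⊕ g₀ ⊕ g₁` on `K ⊕ g₁`, where the grading is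
by the eigenvalues of `ad ω`. -/
def projAction : g →ₗ[K] End K (K × gradeOne K ω) :=
  LinearMap.mk₂ K
    (fun x p ↦ (B x p.2 - B ω x * p.1,
      p.1 • gradeOneProj ω hω x + gradeOneProj ω hω ⁅x, (p.2 : g)⁆ - B ω x • p.2))
    (fun x y p ↦ by
      ext1
      · simp; ring
      · simp; module)
    (fun c x p ↦ by
      ext1
      · simp; ring
      · simp; module)
    (fun x p q ↦ by
      ext1
      · simp; ring
      · simp; module)
    (fun c x p ↦ by
      ext1
      · simp; ring
      · simp; module)

lemma projAction_apply (x : g) (p : K × gradeOne K ω) :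
    projAction ω B hω x p = (B x p.2 - B ω x * p.1,
      p.1 • gradeOneProj ω hω x + gradeOneProj ω hω ⁅x, (p.2 : g)⁆ - B ω x • p.2) := rfl

variable {ω B}

lemma gradeOneProj_of_one [CharZero K] {a : g} (ha : ⁅ω, a⁆ = a) :
    (gradeOneProj (K := K) ω hω a : g) = a := by
  rw [coe_gradeOneProj, ha, ha]
  module

lemma gradeOneProj_of_zero {b : g} (hb : ⁅ω, b⁆ = 0) : gradeOneProj (K := K) ω hω b = 0 := by
  ext1
  rw [coe_gradeOneProj, hb]
  simp

lemma gradeOneProj_of_neg_one {d : g} (hd : ⁅ω, d⁆ = -d) : gradeOneProj (K := K) ω hω d = 0 := by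
  ext1
  rw [coe_gradeOneProj, hd]
  simp [hd]

lemma lie_lie_eq_smul_of_eigen {a b : g} {s t u : K} (ha : ⁅ω, a⁆ = s • a) (hb : ⁅ω, b⁆ = t • b)
    (hu : s + t = u) : ⁅ω, ⁅a, b⁆⁆ = u • ⁅a, b⁆ := by
  rw [leibniz_lie, ha, hb, ← hu]
  simp [add_smul]

lemma eq_zero_of_eigen (hω : ∀ x : g, ⁅ω, ⁅ω, ⁅ω, x⁆⁆⁆ = ⁅ω, x⁆) {a : g} {s : K}
    (ha : ⁅ω, a⁆ = s • a) (hs : s ^ 3 ≠ s) : a = 0 := by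
  have h := hω a
  simp only [ha, lie_smul, smul_smul] at h
  rw [← sub_eq_zero, ← sub_smul, smul_eq_zero] at h
  refine h.resolve_left fun h' ↦ hs ?_
  linear_combination h'

lemma form_eq_zero_of_eigen (hi : ∀ x y z, B ⁅x, y⁆ z = B x ⁅y, z⁆) {a b : g} {s t : K}
    (ha : ⁅ω, a⁆ = s • a) (hb : ⁅ω, b⁆ = t • b) (hst : s + t ≠ 0) : B a b = 0 := by
  have h := hi a ω b
  rw [← lie_skew, ha, hb] at h
  simp only [map_neg, map_smul, LinearMap.neg_apply, LinearMap.smul_apply, smul_eq_mul] at h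
  refine (mul_eq_zero.1 (?_ : (s + t) * B a b = 0)).resolve_left hst
  linear_combination -h

section Components

variable [CharZero K] {a b d : g} (p : K × gradeOne K ω)

lemma coe_projAction_of_one (hi : ∀ x y z, B ⁅x, y⁆ z = B x ⁅y, z⁆) (ha : ⁅ω, a⁆ = a) :
    (projAction ω B hω a p).1 = 0 ∧ ((projAction ω B hω a p).2 : g) = p.1 • a := by
  have hp := mem_gradeOne.1 p.2.2
  have h₁ : B a p.2 = 0 := form_eq_zero_of_eigen hi (s := (1 : K)) (t := 1)
    (by simpa using ha) (by simpa using hp) (by norm_num)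
  have h₂ : B ω a = 0 := form_eq_zero_of_eigen hi (ω := ω) (s := (0 : K)) (t := 1)
    (by simp) (by simpa using ha) (by norm_num)
  have h₃ : ⁅a, (p.2 : g)⁆ = 0 := eq_zero_of_eigen hω (s := (2 : K))
    (lie_lie_eq_smul_of_eigen (s := (1 : K)) (t := 1) (by simpa using ha) (by simpa using hp)
      (by norm_num)) (by norm_num)
  simp [projAction_apply, h₁, h₂, h₃, gradeOneProj_of_one hω ha]

lemma coe_projAction_of_zero (hi : ∀ x y z, B ⁅x, y⁆ z = B x ⁅y, z⁆) (hb : ⁅ω, b⁆ = 0) :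
    (projAction ω B hω b p).1 = -(B ω b * p.1) ∧
      ((projAction ω B hω b p).2 : g) = ⁅b, (p.2 : g)⁆ - B ω b • (p.2 : g) := by
  have hp := mem_gradeOne.1 p.2.2
  have h₁ : B b p.2 = 0 := form_eq_zero_of_eigen hi (s := (0 : K)) (t := 1)
    (by simpa using hb) (by simpa using hp) (by norm_num)
  have h₃ : ⁅ω, ⁅b, (p.2 : g)⁆⁆ = ⁅b, (p.2 : g)⁆ := by
    rw [leibniz_lie, hb, hp, zero_lie, zero_add]
  simp [projAction_apply, h₁, gradeOneProj_of_zero hω hb, gradeOneProj_of_one hω h₃]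

lemma coe_projAction_of_neg_one (hi : ∀ x y z, B ⁅x, y⁆ z = B x ⁅y, z⁆) (hd : ⁅ω, d⁆ = -d) :
    (projAction ω B hω d p).1 = B d p.2 ∧ ((projAction ω B hω d p).2 : g) = 0 := by
  have hp := mem_gradeOne.1 p.2.2
  have h₁ : B ω d = 0 := form_eq_zero_of_eigen hi (ω := ω) (s := (0 : K)) (t := -1)
    (by simp) (by simpa using hd) (by norm_num)
  have h₃ : ⁅ω, ⁅d, (p.2 : g)⁆⁆ = 0 := by
    rw [leibniz_lie, hd, hp, neg_lie, neg_add_cancel]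
  simp [projAction_apply, h₁, gradeOneProj_of_zero hω h₃, gradeOneProj_of_neg_one hω hd]

end Components

/-- `projAction` is a representation of `g`. -/
lemma projAction_lie [CharZero K] (hs : ∀ x y, B x y = B y x)
    (hi : ∀ x y z, B ⁅x, y⁆ z = B x ⁅y, z⁆)
    (hT : ∀ v w x, ⁅ω, v⁆ = v → ⁅ω, w⁆ = w → ⁅⁅v, x⁆, w⁆ = B x v • w + B x w • v) (x y : g) :
    projAction ω B hω ⁅x, y⁆ =
      projAction ω B hω x * projAction ω B hω y - projAction ω B hω y * projAction ω B hω x := by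
  have hsymm : ∀ x y, projAction ω B hω ⁅x, y⁆ = projAction ω B hω x * projAction ω B hω y -
      projAction ω B hω y * projAction ω B hω x → projAction ω B hω ⁅y, x⁆ =
      projAction ω B hω y * projAction ω B hω x - projAction ω B hω x * projAction ω B hω y := by
    intro x y h
    rw [← lie_skew, map_neg, h, neg_sub]
  have h₁ := fun {a} ha p ↦ coe_projAction_of_one hω p hi (a := a) ha
  have h₀ := fun {b} hb p ↦ coe_projAction_of_zero hω p hi (b := b) hb
  have hn := fun {d} hd p ↦ coe_projAction_of_neg_one hω p hi (d := d) hd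
  have h₁₁ : ∀ a a' : g, ⁅ω, a⁆ = a → ⁅ω, a'⁆ = a' → ⁅a, a'⁆ = 0 := fun a a' ha ha' ↦
    eq_zero_of_eigen hω (a := ⁅a, a'⁆) (s := (2 : K))
      (lie_lie_eq_smul_of_eigen (s := (1 : K)) (t := 1)
      (by simpa using ha) (by simpa using ha') (by norm_num)) (by norm_num)
  have hnn : ∀ a a' : g, ⁅ω, a⁆ = -a → ⁅ω, a'⁆ = -a' → ⁅a, a'⁆ = 0 := fun a a' ha ha' ↦
    eq_zero_of_eigen hω (a := ⁅a, a'⁆) (s := (-2 : K))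
      (lie_lie_eq_smul_of_eigen (s := (-1 : K)) (t := -1)
      (by simpa using ha) (by simpa using ha') (by norm_num)) (by norm_num)
  have haa : ∀ a a' : g, ⁅ω, a⁆ = a → ⁅ω, a'⁆ = a' → projAction ω B hω ⁅a, a'⁆ =
      projAction ω B hω a * projAction ω B hω a' - projAction ω B hω a' * projAction ω B hω a := by
    intro a a' ha ha'
    refine LinearMap.ext fun p ↦ Prod.ext ?_ (Subtype.ext ?_) <;>
      simp [h₁₁ a a' ha ha', h₁ ha, h₁ ha']
  have hdd : ∀ a a' : g, ⁅ω, a⁆ = -a → ⁅ω, a'⁆ = -a' → projAction ω B hω ⁅a, a'⁆ =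
      projAction ω B hω a * projAction ω B hω a' - projAction ω B hω a' * projAction ω B hω a := by
    intro a a' ha ha'
    refine LinearMap.ext fun p ↦ Prod.ext ?_ (Subtype.ext ?_) <;>
      simp [hnn a a' ha ha', hn ha, hn ha']
  have hab : ∀ a b : g, ⁅ω, a⁆ = a → ⁅ω, b⁆ = 0 → projAction ω B hω ⁅a, b⁆ =
      projAction ω B hω a * projAction ω B hω b - projAction ω B hω b * projAction ω B hω a := by
    intro a b ha hb
    have hc : ⁅ω, ⁅a, b⁆⁆ = ⁅a, b⁆ := by rw [leibniz_lie, ha, hb, lie_zero, add_zero]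
    refine LinearMap.ext fun p ↦ Prod.ext ?_ (Subtype.ext ?_)
    · simp [h₁ ha, h₀ hb, h₁ hc]
    · simp [h₁ ha, h₀ hb, h₁ hc]
      rw [← lie_skew b a]
      module
  have hbb : ∀ b b' : g, ⁅ω, b⁆ = 0 → ⁅ω, b'⁆ = 0 → projAction ω B hω ⁅b, b'⁆ =
      projAction ω B hω b * projAction ω B hω b' - projAction ω B hω b' * projAction ω B hω b := by
    intro b b' hb hb'
    have hc : ⁅ω, ⁅b, b'⁆⁆ = 0 := by rw [leibniz_lie, hb, hb', lie_zero, zero_lie, add_zero]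
    have hB : B ω ⁅b, b'⁆ = 0 := by rw [← hi, hb]; simp
    refine LinearMap.ext fun p ↦ Prod.ext ?_ (Subtype.ext ?_)
    · simp [h₀ hb, h₀ hb', h₀ hc, hB]
      ring
    · simp [h₀ hb, h₀ hb', h₀ hc, hB]
      module
  have hbd : ∀ b d : g, ⁅ω, b⁆ = 0 → ⁅ω, d⁆ = -d → projAction ω B hω ⁅b, d⁆ =
      projAction ω B hω b * projAction ω B hω d - projAction ω B hω d * projAction ω B hω b := by
    intro b d hb hd
    have hc : ⁅ω, ⁅b, d⁆⁆ = -⁅b, d⁆ := by rw [leibniz_lie, hb, hd, zero_lie, zero_add, lie_neg]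
    refine LinearMap.ext fun p ↦ Prod.ext ?_ (Subtype.ext ?_)
    · have := hi d b p.2
      rw [← lie_skew d b, map_neg, LinearMap.neg_apply] at this
      simp [h₀ hb, hn hd, hn hc]
      linear_combination -this
    · simp [h₀ hb, hn hd, hn hc]
  have had : ∀ a d : g, ⁅ω, a⁆ = a → ⁅ω, d⁆ = -d → projAction ω B hω ⁅a, d⁆ =
      projAction ω B hω a * projAction ω B hω d - projAction ω B hω d * projAction ω B hω a := by
    intro a d ha hd
    have hc : ⁅ω, ⁅a, d⁆⁆ = 0 := by rw [leibniz_lie, ha, hd, lie_neg, add_neg_cancel]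
    have hB : B ω ⁅a, d⁆ = B d a := by rw [← hi, ha, hs]
    refine LinearMap.ext fun p ↦ Prod.ext ?_ (Subtype.ext ?_)
    · simp [h₁ ha, hn hd, h₀ hc, hB]
      ring
    · simp [h₁ ha, hn hd, h₀ hc, hB, hT a p.2 d ha (mem_gradeOne.1 p.2.2)]
  obtain ⟨a, b, d, ha, hb, hd, rfl⟩ := exists_graded_decomposition K hω x
  obtain ⟨a', b', d', ha', hb', hd', rfl⟩ := exists_graded_decomposition K hω y
  simp only [add_lie, lie_add, map_add, haa a a' ha ha', hab a b' ha hb', had a d' ha hd',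
    hsymm _ _ (hab a' b ha' hb), hbb b b' hb hb', hbd b d' hb hd', hsymm _ _ (had a' d ha' hd),
    hsymm _ _ (hbd b' d hb' hd), hdd d d' hd hd']
  noncomm_ring

section Equivalence

variable [LieAlgebra.IsSimple K g]

/-- A representation of a simple Lie algebra is traceless. -/
lemma trace_eq_zero_of_isSimple {W : Type*} [AddCommGroup W] [Module K W]
    (φ : g →ₗ[K] End K W) (hφ : ∀ x y, φ ⁅x, y⁆ = φ x * φ y - φ y * φ x) (x : g) :
    LinearMap.trace K W (φ x) = 0 := by
  have h : ∀ x y : g, LinearMap.trace K W (φ ⁅x, y⁆) = 0 := by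
    intro x y
    rw [hφ, map_sub, LinearMap.trace_mul_comm, sub_self]
  let I : LieIdeal K g :=
    { LinearMap.ker (LinearMap.trace K W ∘ₗ φ) with lie_mem := fun {x y} _ ↦ h x y }
  rcases LieAlgebra.IsSimple.eq_bot_or_eq_top I with hI | hI
  · refine absurd ⟨fun x y ↦ ?_⟩ (LieAlgebra.IsSimple.non_abelian K (L := g))
    rw [← LieSubmodule.mem_bot (R := K) (L := g), ← hI]
    exact h x y
  · have : x ∈ I := hI ▸ LieSubmodule.mem_top x
    exact this

/-- A nonzero representation of a simple Lie algebra is faithful. -/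
lemma injective_of_isSimple {W : Type*} [AddCommGroup W] [Module K W]
    (φ : g →ₗ[K] End K W) (hφ : ∀ x y, φ ⁅x, y⁆ = φ x * φ y - φ y * φ x) (hne : φ ≠ 0) :
    Function.Injective φ := by
  let I : LieIdeal K g := { LinearMap.ker φ with
    lie_mem := fun {x y} hy ↦ by
      have hy : φ y = 0 := hy
      change φ ⁅x, y⁆ = 0
      rw [hφ, hy, mul_zero, zero_mul, sub_zero] }
  rcases LieAlgebra.IsSimple.eq_bot_or_eq_top I with hI | hI
  · rw [← LinearMap.ker_eq_bot, eq_bot_iff]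
    intro x hx
    have : x ∈ I := hx
    rwa [hI, LieSubmodule.mem_bot] at this
  · refine absurd (LinearMap.ext fun x ↦ ?_) hne
    have : x ∈ I := hI ▸ LieSubmodule.mem_top x
    exact this

/-- A subspace of `End (K × V)` which is closed under commutators and contains all maps `K → V` and
all maps `V → K` contains all traceless endomorphisms. -/
lemma mem_of_trace_eq_zero {V : Type*} [AddCommGroup V] [Module K V] [FiniteDimensional K V]
    (R : Submodule K (End K (K × V))) (hR : ∀ S ∈ R, ∀ T ∈ R, S * T - T * S ∈ R)
    (htr : ∀ T ∈ R, LinearMap.trace K (K × V) T = 0)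
    (hU : ∀ v : V, LinearMap.inr K K V ∘ₗ LinearMap.toSpanSingleton K V v ∘ₗ
      LinearMap.fst K K V ∈ R)
    (hD : ∀ ψ : Dual K V, LinearMap.inl K K V ∘ₗ ψ ∘ₗ LinearMap.snd K K V ∈ R)
    (T : End K (K × V)) (hT : LinearMap.trace K (K × V) T = 0) : T ∈ R := by
  let Θ : End K V →ₗ[K] End K (K × V) := LinearMap.mk₂ K
    (fun A p ↦ (-(LinearMap.trace K V A * p.1), A p.2))
    (fun A A' p ↦ by ext1 <;> simp; ring) (fun c A p ↦ by ext1 <;> simp; ring)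
    (fun A p q ↦ by ext1 <;> simp; ring) (fun c A p ↦ by ext1 <;> simp; ring)
  have hΘ : ∀ A, Θ A ∈ R := by
    intro A
    obtain ⟨t, rfl⟩ := (dualTensorHomEquiv K V V).surjective A
    induction t with
    | zero => simp
    | add s t hs ht => rw [map_add, map_add]; exact add_mem hs ht
    | tmul ψ v =>
      convert hR _ (hU v) _ (hD ψ) using 1
      refine LinearMap.ext fun p ↦ ?_
      have htr' : LinearMap.trace K V (dualTensorHom K V V (ψ ⊗ₜ[K] v)) = ψ v := by
        rw [LinearMap.trace_eq_contract_apply, contractLeft_apply]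
      ext1 <;> simp [Θ, htr', mul_comm]
  let A : End K V := LinearMap.snd K K V ∘ₗ T ∘ₗ LinearMap.inr K K V
  let P : End K (K × V) := LinearMap.inl K K V ∘ₗ LinearMap.fst K K V
  let ψ : Dual K V := LinearMap.fst K K V ∘ₗ T ∘ₗ LinearMap.inr K K V
  have hP : LinearMap.trace K (K × V) P = 1 := by
    have : P = LinearMap.prodMap LinearMap.id 0 := by
      refine LinearMap.ext fun p ↦ ?_
      simp [P]
    rw [this, LinearMap.trace_prodMap']
    simp
  have hdec : T = LinearMap.inr K K V ∘ₗ LinearMap.toSpanSingleton K V (T (1, 0)).2 ∘ₗ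
      LinearMap.fst K K V + LinearMap.inl K K V ∘ₗ ψ ∘ₗ LinearMap.snd K K V + Θ A +
      ((T (1, 0)).1 + LinearMap.trace K V A) • P := by
    refine LinearMap.ext fun p ↦ ?_
    have hp : p = p.1 • ((1 : K), (0 : V)) + (0, p.2) := by ext1 <;> simp
    conv_lhs => rw [hp, map_add, map_smul]
    ext1
    · simp [Θ, P, ψ]
      ring
    · simp [Θ, P, A]
  have hs : (T (1, 0)).1 + LinearMap.trace K V A = 0 := by
    rw [hdec, map_add, map_smul, hP, map_add, map_add, htr _ (hU _), htr _ (hD _),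
      htr _ (hΘ _)] at hT
    simpa using hT
  rw [hdec, hs, zero_smul, add_zero]
  exact add_mem (add_mem (hU _) (hD _)) (hΘ _)

/-- A simple Lie algebra with a grading by `-1, 0, 1` in which the degree one part acts on itself
like infinitesimal projective transformations is isomorphic to `sl_n`. -/
theorem nonempty_lieEquiv_sl_of_projective [CharZero K] [FiniteDimensional K g]
    (hω : ∀ x : g, ⁅ω, ⁅ω, ⁅ω, x⁆⁆⁆ = ⁅ω, x⁆) (hs : ∀ x y, B x y = B y x)
    (hi : ∀ x y z, B ⁅x, y⁆ z = B x ⁅y, z⁆) (hB : B.Nondegenerate)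
    (hT : ∀ v w x, ⁅ω, v⁆ = v → ⁅ω, w⁆ = w → ⁅⁅v, x⁆, w⁆ = B x v • w + B x w • v)
    (hV : gradeOne K ω ≠ ⊥) :
    Nonempty (g ≃ₗ⁅K⁆ LieAlgebra.SpecialLinear.sl (Fin (finrank K (gradeOne K ω) + 1)) K) := by
  have hφ := projAction_lie hω hs hi hT
  have htr := trace_eq_zero_of_isSimple _ hφ
  have hU : ∀ v : gradeOne K ω, projAction ω B hω v = LinearMap.inr K K (gradeOne K ω) ∘ₗ
      LinearMap.toSpanSingleton K _ v ∘ₗ LinearMap.fst K K _ := by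
    intro v
    refine LinearMap.ext fun p ↦ Prod.ext ?_ (Subtype.ext ?_) <;>
      simp [coe_projAction_of_one hω p hi (mem_gradeOne.1 v.2)]
  have hne : projAction ω B hω ≠ 0 := by
    obtain ⟨v, hv, hv0⟩ := (Submodule.ne_bot_iff _).1 hV
    intro h
    have h' := congrArg (fun T ↦ ((T (1, 0)).2 : g)) (hU ⟨v, hv⟩)
    simp [h] at h'
    exact hv0 h'.symm
  have hD : ∀ ψ : Dual K (gradeOne K ω), LinearMap.inl K K _ ∘ₗ ψ ∘ₗ LinearMap.snd K K _ ∈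
      LinearMap.range (projAction ω B hω) := by
    intro ψ
    obtain ⟨Ψ, hΨ⟩ := LinearMap.exists_extend ψ
    obtain ⟨x, hx⟩ := (B.toDual hB).surjective Ψ
    obtain ⟨a, b, d, ha, hb, hd, rfl⟩ := exists_graded_decomposition K hω x
    refine ⟨d, LinearMap.ext fun p ↦ Prod.ext ?_ (Subtype.ext ?_)⟩
    · have hp := mem_gradeOne.1 p.2.2
      have h₁ : B a p.2 = 0 := form_eq_zero_of_eigen hi (s := (1 : K)) (t := 1)
        (by simpa using ha) (by simpa using hp) (by norm_num)
      have h₀ : B b p.2 = 0 := form_eq_zero_of_eigen hi (s := (0 : K)) (t := 1)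
        (by simpa using hb) (by simpa using hp) (by norm_num)
      have h₂ : ψ p.2 = Ψ p.2 := by rw [← hΨ]; rfl
      have h₃ := LinearMap.congr_fun hx (p.2 : g)
      rw [LinearMap.BilinForm.toDual_def, map_add, map_add, LinearMap.add_apply,
        LinearMap.add_apply, h₁, h₀, zero_add, zero_add] at h₃
      simp [coe_projAction_of_neg_one hω p hi hd, h₂, h₃]
    · simp [coe_projAction_of_neg_one hω p hi hd]
  have hfin : finrank K (gradeOne K ω) + 1 = finrank K (K × gradeOne K ω) := by
    rw [finrank_prod, finrank_self, add_comm]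
  rw [hfin]
  refine nonempty_lieEquiv_sl_of_traceless _ hφ (injective_of_isSimple _ hφ hne) fun T ↦ ⟨?_, ?_⟩
  · rintro ⟨x, rfl⟩
    exact htr x
  · refine mem_of_trace_eq_zero _ ?_ ?_ (fun v ↦ hU v ▸ ⟨v, rfl⟩) hD T
    · rintro _ ⟨x, rfl⟩ _ ⟨y, rfl⟩
      exact ⟨⁅x, y⁆, hφ x y⟩
    · rintro _ ⟨x, rfl⟩
      exact htr x

end Equivalence

end ProjectiveAction

section HighestRoot

open LieAlgebra LieAlgebra.IsKilling LieModule Module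

variable {g : Type*} [LieRing g] [LieAlgebra ℂ g] {H : LieSubalgebra ℂ g}

/-- `θ` is the highest root for the total order on weights defined by the real functional `ℓ`. -/
structure IsHighestRoot [LieRing.IsNilpotent H] (ℓ : (H → ℂ) →ₗ[ℝ] ℝ) (θ : Weight ℂ H g) :
    Prop where
  isNonZero : θ.IsNonZero
  injective : ∀ χ ψ : Weight ℂ H g, ℓ χ = ℓ ψ → χ = ψ
  le : ∀ χ : Weight ℂ H g, ℓ χ ≤ ℓ θ

lemma exists_weight_of_ne_zero [LieRing.IsNilpotent H] {χ : H → ℂ} {x : g}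
    (hx : x ∈ rootSpace H χ) (h : x ≠ 0) :
    ∃ ψ : Weight ℂ H g, (ψ : H → ℂ) = χ :=
  ⟨⟨χ, fun hχ ↦ h ((LieSubmodule.mem_bot x).1 ((show rootSpace H χ = ⊥ from hχ) ▸ hx))⟩, rfl⟩

lemma IsHighestRoot.eq_zero_of_lt [LieRing.IsNilpotent H] {ℓ : (H → ℂ) →ₗ[ℝ] ℝ}
    {θ : Weight ℂ H g} (h : IsHighestRoot ℓ θ) {χ : H → ℂ} {x : g} (hx : x ∈ rootSpace H χ)
    (hlt : ℓ θ < ℓ χ) : x = 0 := by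
  by_contra hne
  obtain ⟨ψ, rfl⟩ := exists_weight_of_ne_zero hx hne
  exact absurd (h.le ψ) (not_le.2 hlt)

variable [FiniteDimensional ℂ g] [H.IsCartanSubalgebra]

/-- A subspace containing all root spaces is everything. -/
lemma eq_top_of_rootSpace_le (S : Submodule ℂ g)
    (h : ∀ (χ : Weight ℂ H g), ∀ x ∈ rootSpace H χ, x ∈ S) : S = ⊤ := by
  have htop := congrArg LieSubmodule.toSubmodule (iSup_genWeightSpace_eq_top' ℂ H g)
  rw [LieSubmodule.iSup_toSubmodule, LieSubmodule.top_toSubmodule] at htop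
  rw [eq_top_iff, ← htop]
  exact iSup_le fun χ x hx ↦ h χ x hx

/-- An element commuting with a Cartan subalgebra belongs to it. -/
lemma mem_cartan_of_lie_eq_zero {x : g} (hx : ∀ a : H, ⁅(a : g), x⁆ = 0) : x ∈ H := by
  have h : x ∈ rootSpace H (0 : H → ℂ) := by
    refine weightSpace_le_genWeightSpace g _ ?_
    rw [mem_weightSpace]
    intro a
    rw [Pi.zero_apply, zero_smul]
    exact hx a
  rwa [rootSpace_zero_eq] at h

variable [IsKilling ℂ g]

lemma coe_lie_eq_smul_of_mem_rootSpace {χ : H → ℂ} {x : g} (hx : x ∈ rootSpace H χ) (a : H) :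
    ⁅(a : g), x⁆ = χ a • x :=
  lie_eq_smul_of_mem_rootSpace hx a

lemma exists_weight_reflect (α β : Weight ℂ H g) :
    ∃ ρ : Weight ℂ H g, (ρ : H → ℂ) = β - β (coroot α) • (α : H → ℂ) :=
  ⟨reflectRoot α β, rfl⟩

/-- The difference of two roots enclosing an acute angle is a weight. -/
lemma exists_weight_sub {α β : Weight ℂ H g} (hα : α.IsNonZero) {k : ℤ}
    (hk : β (coroot α) = k) (hpos : 0 < k) :
    ∃ ρ : Weight ℂ H g, (ρ : H → ℂ) = β - α := by
  have hne : rootSpace H ((-1 : ℤ) • (α : H → ℂ) + β) ≠ ⊥ := by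
    rw [rootSpace_zsmul_add_ne_bot_iff α β hα]
    rw [apply_coroot_eq_cast, Int.cast_inj] at hk
    lia
  refine ⟨⟨_, hne⟩, ?_⟩
  change (-1 : ℤ) • (α : H → ℂ) + β = _
  rw [neg_one_zsmul, sub_eq_neg_add]

lemma exists_int_apply_coroot (α β : Weight ℂ H g) : ∃ k : ℤ, β (coroot α) = k :=
  ⟨_, apply_coroot_eq_cast α β⟩

/-- The sign of the pairing of two roots is symmetric. -/
lemma pairing_pos_symm {α β : Weight ℂ H g} (hα : α.IsNonZero) (hβ : β.IsNonZero) {k m : ℤ}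
    (hk : β (coroot α) = k) (hm : α (coroot β) = m) (hpos : 0 < k) : 0 < m := by
  let a : H.root := ⟨α, by simpa using hα⟩
  let b : H.root := ⟨β, by simpa using hβ⟩
  have h₁ : (rootSystem H).pairingIn ℤ b a = k := by
    have := (rootSystem H).algebraMap_pairingIn ℤ b a
    rw [rootSystem_pairing_apply] at this
    exact Int.cast_injective (this.trans hk)
  have h₂ : (rootSystem H).pairingIn ℤ a b = m := by
    have := (rootSystem H).algebraMap_pairingIn ℤ a b
    rw [rootSystem_pairing_apply] at this
    exact Int.cast_injective (this.trans hm)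
  rw [← h₂, ← (rootSystem H).zero_lt_pairingIn_iff' ℤ, h₁]
  exact hpos

/-- Every complex Lie algebra with nondegenerate Killing form has a highest root. -/
lemma exists_isHighestRoot [Nontrivial g] (H : LieSubalgebra ℂ g) [H.IsCartanSubalgebra] :
    ∃ (ℓ : (H → ℂ) →ₗ[ℝ] ℝ) (θ : Weight ℂ H g), IsHighestRoot ℓ θ := by
  obtain ⟨ℓ, hℓ⟩ := Module.exists_dual_forall_apply_ne_zero (K := ℝ)
    (fun p : {p : Weight ℂ H g × Weight ℂ H g // p.1 ≠ p.2} ↦ (p.1.1 : H → ℂ) - p.1.2)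
    fun p h ↦ p.2 (DFunLike.coe_injective (sub_eq_zero.1 h))
  have hinj : ∀ χ ψ : Weight ℂ H g, ℓ χ = ℓ ψ → χ = ψ := by
    intro χ ψ h
    by_contra hne
    exact hℓ ⟨(χ, ψ), hne⟩ (by rw [map_sub, h, sub_self])
  obtain ⟨θ, hθ⟩ := Finite.exists_max fun χ : Weight ℂ H g ↦ ℓ χ
  refine ⟨ℓ, θ, fun hzero ↦ ?_, hinj, hθ⟩
  have hall : ∀ χ : Weight ℂ H g, χ = θ := by
    intro χ
    have h₁ := hθ χ
    have h₂ := hθ (-χ)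
    rw [Weight.coe_neg, map_neg] at h₂
    rw [hzero.eq, map_zero] at h₁ h₂
    exact hinj _ _ (by rw [hzero.eq, map_zero]; linarith)
  have hspan := span_weight_isNonZero_eq_top ℂ g H
  have hempty : {α : Weight ℂ H g | α.IsNonZero} = ∅ := by
    ext α
    simpa [hall α] using hzero
  rw [hempty, Set.image_empty, Submodule.span_empty] at hspan
  have h0 : Subsingleton (Dual ℂ H) := by
    rw [← Submodule.subsingleton_iff ℂ, ← subsingleton_iff_bot_eq_top]
    exact hspan
  have hH : Subsingleton H := by
    rw [← not_nontrivial_iff_subsingleton]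
    intro _
    obtain ⟨x, hx⟩ := exists_ne (0 : H)
    obtain ⟨f, hf⟩ := (exists_dual_forall_apply_ne_zero (K := ℂ) (fun _ : Unit ↦ x) fun _ ↦ hx)
    exact hf () (by rw [Subsingleton.elim f 0, LinearMap.zero_apply])
  have htop := eq_top_of_rootSpace_le (H := H) ⊥ fun χ x hx ↦ by
    rw [hall χ, hzero.eq, rootSpace_zero_eq] at hx
    exact congrArg Subtype.val (Subsingleton.elim (⟨x, hx⟩ : H) 0)
  exact bot_ne_top htop

namespace IsHighestRoot

variable {ℓ : (H → ℂ) →ₗ[ℝ] ℝ} {θ : Weight ℂ H g}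

lemma pos (h : IsHighestRoot ℓ θ) : 0 < ℓ θ := by
  have h₁ := h.le (-θ)
  rw [Weight.coe_neg, map_neg] at h₁
  have h₂ : ℓ θ ≠ ℓ (-θ : Weight ℂ H g) := fun h' ↦ by
    have h₃ := congrArg (fun χ : Weight ℂ H g ↦ χ (coroot θ)) (h.injective _ _ h')
    simp only [Weight.coe_neg, Pi.neg_apply, root_apply_coroot h.isNonZero] at h₃
    norm_num at h₃
  rw [Weight.coe_neg, map_neg] at h₂
  refine lt_of_le_of_ne (by linarith) fun h₃ ↦ h₂ (by linarith)

lemma eq_of_apply_eq_zero (h : IsHighestRoot ℓ θ) {χ : Weight ℂ H g} (hχ : ℓ χ = 0) :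
    (χ : H → ℂ) = 0 := by
  by_contra hne
  have h₁ : ℓ χ = ℓ (-χ : Weight ℂ H g) := by rw [Weight.coe_neg, map_neg, hχ, neg_zero]
  have h₂ := congrArg (fun ψ : Weight ℂ H g ↦ ψ (coroot χ)) (h.injective _ _ h₁)
  simp only [Weight.coe_neg, Pi.neg_apply, root_apply_coroot (α := χ) hne] at h₂
  norm_num at h₂

lemma apply_neg_of_apply_coroot_neg (h : IsHighestRoot ℓ θ) {χ : Weight ℂ H g} {k : ℤ}
    (hk : χ (coroot θ) = k) (hneg : k < 0) : ℓ χ < 0 := by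
  have hk' : χ (coroot (-θ)) = (-k : ℤ) := by simp [coroot_neg, hk]
  obtain ⟨ρ, hρ⟩ := exists_weight_sub h.isNonZero.neg hk' (by lia)
  have h₁ := h.le ρ
  rw [hρ, Weight.coe_neg, sub_neg_eq_add, map_add] at h₁
  refine lt_of_le_of_ne (by linarith) fun h₂ ↦ ?_
  rw [h.eq_of_apply_eq_zero h₂] at hk
  have : (k : ℂ) = 0 := by simpa using hk.symm
  exact hneg.ne (by exact_mod_cast this)

/-- The pairing of a root with the coroot of the highest root. -/
lemma pairing_cases (h : IsHighestRoot ℓ θ) (χ : Weight ℂ H g) :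
    χ (coroot θ) = 0 ∨ χ (coroot θ) = 1 ∨ χ (coroot θ) = -1 ∨ χ = θ ∨ χ = -θ := by
  have key : ∀ (χ : Weight ℂ H g) (k : ℤ), χ (coroot θ) = k → 2 ≤ k → χ = θ := by
    intro χ k hk h2
    obtain ⟨ρ, hρ⟩ := exists_weight_reflect θ χ
    have h₁ := h.le (-ρ)
    have h₂ : (k : ℂ) • (θ : H → ℂ) = (k : ℝ) • (θ : H → ℂ) := by
      ext a
      simp
    rw [Weight.coe_neg, hρ, hk, map_neg, map_sub, h₂, map_smul, smul_eq_mul] at h₁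
    have h₃ : (2 : ℝ) ≤ k := by exact_mod_cast h2
    exact h.injective _ _ (le_antisymm (h.le χ) (by nlinarith [h.pos]))
  obtain ⟨k, hk⟩ := exists_int_apply_coroot θ χ
  rcases lt_or_ge k 2 with h2 | h2
  · rcases lt_or_ge (-2) k with h2' | h2'
    · obtain rfl | rfl | rfl : k = 0 ∨ k = 1 ∨ k = -1 := by lia
      all_goals simp [hk]
    · have := key (-χ) (-k) (by simp [hk]) (by lia)
      refine .inr (.inr (.inr (.inr ?_)))
      rw [← this, neg_neg]
  · exact .inr (.inr (.inr (.inl (key χ k hk h2))))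

/-- A subspace which contains a lowest root vector and is stable under the nonnegative part of a
simple Lie algebra is everything. -/
lemma eq_top_of_lowest_mem [IsSimple ℂ g] (h : IsHighestRoot ℓ θ)
    {f : g} (hf : f ∈ rootSpace H (-θ : H → ℂ)) (hf0 : f ≠ 0)
    (M : Submodule ℂ g) (hfM : f ∈ M) (hM : ∀ χ : Weight ℂ H g, 0 ≤ ℓ χ → ∀ a ∈ rootSpace H χ,
      ∀ x ∈ M, ⁅a, x⁆ ∈ M) : M = ⊤ := by
  let 𝒮 : Set (Submodule ℂ g) := {N | f ∈ N ∧ ∀ χ : Weight ℂ H g, 0 ≤ ℓ χ →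
    ∀ a ∈ rootSpace H χ, ∀ x ∈ N, ⁅a, x⁆ ∈ N}
  let N := sInf 𝒮
  have hN : N ∈ 𝒮 := ⟨(Submodule.mem_sInf).2 fun N hN ↦ hN.1, fun χ hχ a ha x hx ↦
    Submodule.mem_sInf.2 fun N' hN' ↦ hN'.2 χ hχ a ha x (Submodule.mem_sInf.1 hx N' hN')⟩
  let N' : Submodule ℂ g :=
    { carrier := {m | m ∈ N ∧ ∀ x : g, ⁅x, m⁆ ∈ N}
      add_mem' := fun {a b} ha hb ↦ ⟨add_mem ha.1 hb.1, fun x ↦ by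
        rw [lie_add]; exact add_mem (ha.2 x) (hb.2 x)⟩
      zero_mem' := ⟨zero_mem _, fun x ↦ by rw [lie_zero]; exact zero_mem _⟩
      smul_mem' := fun c a ha ↦ ⟨N.smul_mem c ha.1, fun x ↦ by
        rw [lie_smul]; exact N.smul_mem c (ha.2 x)⟩ }
  have hN' : N' ∈ 𝒮 := by
    refine ⟨⟨hN.1, fun x ↦ ?_⟩, fun χ hχ a ha m hm ↦ ⟨hN.2 χ hχ a ha m hm.1, fun x ↦ ?_⟩⟩
    · have := eq_top_of_rootSpace_le (H := H) (N.comap (LieAlgebra.ad ℂ g f : g →ₗ[ℂ] g))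
        fun χ x hx ↦ ?_
      · have hx : x ∈ N.comap (LieAlgebra.ad ℂ g f : g →ₗ[ℂ] g) := this ▸ trivial
        rw [← lie_skew, neg_mem_iff]
        exact hx
      · change ⁅f, x⁆ ∈ N
        rw [← lie_skew, neg_mem_iff]
        rcases le_or_gt 0 (ℓ χ) with hχ | hχ
        · exact hN.2 χ hχ x hx f hN.1
        · have h₁ := lie_mem_genWeightSpace_of_mem_genWeightSpace hx hf
          suffices ⁅x, f⁆ = 0 by rw [this]; exact zero_mem _
          by_contra hne
          obtain ⟨ψ, hψ⟩ := exists_weight_of_ne_zero h₁ hne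
          have h₂ := h.le (-ψ)
          rw [Weight.coe_neg, hψ, map_neg, map_add, map_neg] at h₂
          linarith
    · rw [leibniz_lie]
      exact add_mem (hm.2 ⁅x, a⁆) (hN.2 χ hχ a ha _ (hm.2 x))
  let I : LieIdeal ℂ g := { N with
    lie_mem := fun {x m} hm ↦ (sInf_le hN' hm : m ∈ N').2 x }
  have hfI : f ∈ I := hN.1
  rcases IsSimple.eq_bot_or_eq_top I with hI | hI
  · rw [hI, LieSubmodule.mem_bot] at hfI
    exact absurd hfI hf0
  · rw [eq_top_iff]
    intro x _
    have hx : x ∈ I := hI ▸ LieSubmodule.mem_top x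
    exact (sInf_le ⟨hfM, hM⟩ : N ≤ M) hx

end IsHighestRoot

end HighestRoot

section Uniqueness

open LieAlgebra LieAlgebra.IsKilling LieModule Module

variable {g : Type*} [LieRing g] [LieAlgebra ℂ g] [FiniteDimensional ℂ g] [IsSimple ℂ g]
  {H : LieSubalgebra ℂ g} [H.IsCartanSubalgebra] {ℓ : (H → ℂ) →ₗ[ℝ] ℝ} {θ : Weight ℂ H g}
  {e f : g} {F : g →ₗ[ℂ] g →ₗ[ℂ] g}

namespace IsHighestRoot

/-- The nonnegative part of the Lie algebra acts on the highest root vector by scalars. -/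
lemma exists_lie_eq_smul (h : IsHighestRoot ℓ θ) (he : e ∈ rootSpace H θ) {χ : Weight ℂ H g}
    (hχ : 0 ≤ ℓ χ) {a : g} (ha : a ∈ rootSpace H χ) : ∃ c : ℂ, ⁅a, e⁆ = c • e := by
  rcases hχ.eq_or_lt with h0 | hpos
  · rw [h.eq_of_apply_eq_zero h0.symm, rootSpace_zero_eq] at ha
    exact ⟨_, lie_eq_smul_of_mem_rootSpace he ⟨a, ha⟩⟩
  · refine ⟨0, ?_⟩
    rw [zero_smul]
    refine h.eq_zero_of_lt (lie_mem_genWeightSpace_of_mem_genWeightSpace ha he) ?_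
    rw [map_add]
    linarith

/-- An equivariant bilinear map is determined by its value on a highest and a lowest root
vector. -/
lemma eq_zero_of_apply_eq_zero (h : IsHighestRoot ℓ θ) (he : e ∈ rootSpace H θ) (he0 : e ≠ 0)
    (hf : f ∈ rootSpace H (-θ : H → ℂ)) (hf0 : f ≠ 0)
    (hF : ∀ x y z : g, F ⁅x, y⁆ z + F y ⁅x, z⁆ = ⁅x, F y z⁆) (hef : F e f = 0) : F = 0 := by
  have hker : LinearMap.ker (F e) = ⊤ := by
    refine h.eq_top_of_lowest_mem hf hf0 _ hef fun χ hχ a ha x hx ↦ ?_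
    obtain ⟨c, hc⟩ := h.exists_lie_eq_smul he hχ ha
    have h₁ := hF a e x
    rw [LinearMap.mem_ker] at hx
    rwa [hc, map_smul, LinearMap.smul_apply, hx, smul_zero, zero_add, lie_zero] at h₁
  let I : LieIdeal ℂ g := { LinearMap.ker F with
    lie_mem := fun {x y} hy ↦ by
      change F y = 0 at hy
      change F ⁅x, y⁆ = 0
      ext z
      simpa [hy] using hF x y z }
  have heI : e ∈ I := LinearMap.ker_eq_top.1 hker
  rcases IsSimple.eq_bot_or_eq_top I with hI | hI
  · rw [hI, LieSubmodule.mem_bot] at heI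
    exact absurd heI he0
  · ext1 x
    have hx : x ∈ I := hI ▸ LieSubmodule.mem_top x
    exact hx

/-- Roots orthogonal to the highest root are strongly orthogonal to it. -/
lemma lie_eq_zero_of_orthogonal (h : IsHighestRoot ℓ θ) {γ : Weight ℂ H g}
    (hγ : γ (coroot θ) = 0) (hγ0 : γ.IsNonZero) {x : g} (hx : x ∈ rootSpace H γ)
    (he : e ∈ rootSpace H θ) : ⁅x, e⁆ = 0 := by
  by_contra hne
  obtain ⟨ρ, hρ⟩ := exists_weight_of_ne_zero
    (lie_mem_genWeightSpace_of_mem_genWeightSpace hx he) hne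
  obtain ⟨σ, hσ⟩ := exists_weight_reflect θ ρ
  have h₁ := h.le ρ
  have h₂ := h.le (-σ)
  rw [Weight.coe_neg, hσ, hρ, Pi.add_apply, hγ, root_apply_coroot h.isNonZero, zero_add, two_smul,
    map_neg, map_sub, map_add, map_add] at h₂
  rw [hρ, map_add] at h₁
  exact hγ0 (h.eq_of_apply_eq_zero (by linarith))

lemma lie_eq_zero_of_orthogonal_neg (h : IsHighestRoot ℓ θ) {γ : Weight ℂ H g}
    (hγ : γ (coroot θ) = 0) (hγ0 : γ.IsNonZero) {x : g} (hx : x ∈ rootSpace H γ)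
    (hf : f ∈ rootSpace H (-θ : H → ℂ)) : ⁅x, f⁆ = 0 := by
  by_contra hne
  obtain ⟨ρ, hρ⟩ := exists_weight_of_ne_zero
    (lie_mem_genWeightSpace_of_mem_genWeightSpace hx hf) hne
  obtain ⟨σ, hσ⟩ := exists_weight_reflect θ ρ
  have h₁ := h.le σ
  have h₂ := h.le (-ρ)
  rw [hσ, hρ, Pi.add_apply, Pi.neg_apply, hγ, root_apply_coroot h.isNonZero, zero_add, neg_smul,
    two_smul, sub_neg_eq_add, map_add, map_add, map_add, map_neg] at h₁
  rw [Weight.coe_neg, hρ, map_neg, map_add, map_neg] at h₂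
  exact hγ0 (h.eq_of_apply_eq_zero (by linarith))

/-- The value of an equivariant bilinear map on a highest and a lowest root vector lies in the
Cartan subalgebra and is killed by all roots orthogonal to the highest root. -/
lemma exists_apply_eq_coe (h : IsHighestRoot ℓ θ) (he : e ∈ rootSpace H θ)
    (hf : f ∈ rootSpace H (-θ : H → ℂ)) (hF : ∀ x y z : g, F ⁅x, y⁆ z + F y ⁅x, z⁆ = ⁅x, F y z⁆) :
    ∃ E : H, F e f = E ∧ ∀ γ : Weight ℂ H g, γ (coroot θ) = 0 → γ E = 0 := by
  have hmem : F e f ∈ H := mem_cartan_of_lie_eq_zero fun a ↦ by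
    rw [← hF, coe_lie_eq_smul_of_mem_rootSpace he, coe_lie_eq_smul_of_mem_rootSpace hf]
    simp
  refine ⟨⟨F e f, hmem⟩, rfl, fun γ hγ ↦ ?_⟩
  by_cases hγ0 : γ.IsZero
  · rw [hγ0.eq, Pi.zero_apply]
  obtain ⟨x, hx, hx0⟩ := γ.exists_ne_zero
  have h₁ := hF x e f
  rw [h.lie_eq_zero_of_orthogonal hγ hγ0 hx he, h.lie_eq_zero_of_orthogonal_neg hγ hγ0 hx hf,
    map_zero, map_zero, LinearMap.zero_apply, add_zero, ← lie_skew, eq_comm, neg_eq_zero] at h₁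
  have h₂ := coe_lie_eq_smul_of_mem_rootSpace hx (⟨F e f, hmem⟩ : H)
  rw [h₁, eq_comm, smul_eq_zero] at h₂
  exact h₂.resolve_right hx0

end IsHighestRoot

end Uniqueness

section Splitting

open LieAlgebra LieAlgebra.IsKilling LieModule Module

variable {g : Type*} [LieRing g] [LieAlgebra ℂ g] [FiniteDimensional ℂ g] [IsKilling ℂ g]
  {H : LieSubalgebra ℂ g} [H.IsCartanSubalgebra] {ℓ : (H → ℂ) →ₗ[ℝ] ℝ} {θ : Weight ℂ H g}

/-- An element `E` of the Cartan subalgebra splitting the roots which have pairing one with the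
root `θ` into two halves, according to their value `±1` on `E`. -/
structure IsSplitting (θ : Weight ℂ H g) (E : H) : Prop where
  apply_self : θ E = 0
  apply_orthogonal : ∀ γ : Weight ℂ H g, γ (coroot θ) = 0 → γ E = 0
  apply_cases : ∀ γ : Weight ℂ H g, γ (coroot θ) = 1 → γ E = 1 ∨ γ E = -1

namespace IsHighestRoot

lemma exists_apply_ne_zero (h : IsHighestRoot ℓ θ) {E : H} (hE : E ≠ 0) (hθ : θ E = 0)
    (horth : ∀ γ : Weight ℂ H g, γ (coroot θ) = 0 → γ E = 0) :
    ∃ γ : Weight ℂ H g, γ (coroot θ) = 1 ∧ γ E ≠ 0 := by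
  have hmem : E ∉ ⨅ α : Weight ℂ H g, α.ker := by
    rwa [iInf_ker_weight_eq_bot]
  rw [Submodule.mem_iInf, not_forall] at hmem
  obtain ⟨γ, hγ⟩ := hmem
  have hγ : γ E ≠ 0 := hγ
  rcases h.pairing_cases γ with h₀ | h₁ | h₂ | rfl | rfl
  · exact absurd (horth γ h₀) hγ
  · exact ⟨γ, h₁, hγ⟩
  · exact ⟨-γ, by simp [h₂], by simpa using hγ⟩
  · exact absurd hθ hγ
  · exact absurd hθ (by simpa using hγ)

lemma eq_or_eq_neg (h : IsHighestRoot ℓ θ) {E : H} (hθ : θ E = 0)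
    (horth : ∀ γ : Weight ℂ H g, γ (coroot θ) = 0 → γ E = 0) {γ δ : Weight ℂ H g}
    (hγ : γ (coroot θ) = 1) (hδ : δ (coroot θ) = 1) : δ E = γ E ∨ δ E = -γ E := by
  have hγ0 : γ.IsNonZero := fun hz ↦ by simp [hz.eq] at hγ
  obtain ⟨k, hk⟩ := exists_int_apply_coroot γ δ
  obtain ⟨m, hm⟩ := exists_int_apply_coroot γ θ
  obtain ⟨σ, hσ⟩ := exists_weight_reflect θ δ
  rw [hδ, one_smul] at hσ
  have hm0 : 0 < m := pairing_pos_symm h.isNonZero hγ0 (k := 1) (by simpa using hγ) hm one_pos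
  rcases lt_or_ge 0 k with hk0 | hk0
  · obtain ⟨ρ, hρ⟩ := exists_weight_sub hγ0 hk hk0
    have h₁ := horth ρ (by rw [hρ, Pi.sub_apply, hγ, hδ, sub_self])
    rw [hρ, Pi.sub_apply, sub_eq_zero] at h₁
    exact .inl h₁
  · have hσk : (-σ) (coroot γ) = (m - k : ℤ) := by
      rw [Weight.coe_neg, hσ, Pi.neg_apply, Pi.sub_apply, hk, hm]
      push_cast
      ring
    obtain ⟨ρ, hρ⟩ := exists_weight_sub hγ0 hσk (by lia)
    rw [Weight.coe_neg, hσ] at hρ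
    have h₁ := horth ρ (by
      rw [hρ, Pi.sub_apply, Pi.neg_apply, Pi.sub_apply, hγ, hδ, root_apply_coroot h.isNonZero]
      norm_num)
    rw [hρ, Pi.sub_apply, Pi.neg_apply, Pi.sub_apply, hθ] at h₁
    exact .inr (by linear_combination -h₁)

/-- A Cartan element killed by the highest root and by all roots orthogonal to it can be rescaled
to a splitting element. -/
lemma exists_isSplitting (h : IsHighestRoot ℓ θ) {E : H} (hE : E ≠ 0) (hθ : θ E = 0)
    (horth : ∀ γ : Weight ℂ H g, γ (coroot θ) = 0 → γ E = 0) :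
    ∃ E' : H, IsSplitting θ E' ∧ ∃ γ : Weight ℂ H g, γ (coroot θ) = 1 ∧ γ E' = 1 := by
  obtain ⟨γ, hγ, hc⟩ := h.exists_apply_ne_zero hE hθ horth
  have key : ∀ χ : Weight ℂ H g, χ ((γ E)⁻¹ • E) = (γ E)⁻¹ * χ E := fun χ ↦
    map_smul χ.toLinear _ _
  refine ⟨(γ E)⁻¹ • E, ⟨by rw [key, hθ, mul_zero], fun δ hδ ↦ by rw [key, horth δ hδ, mul_zero],
    fun δ hδ ↦ ?_⟩, γ, hγ, by rw [key, inv_mul_cancel₀ hc]⟩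
  rw [key]
  refine (h.eq_or_eq_neg hθ horth hγ hδ).imp (fun h' ↦ ?_) fun h' ↦ ?_
  · rw [h', inv_mul_cancel₀ hc]
  · rw [h', mul_neg, inv_mul_cancel₀ hc]

end IsHighestRoot

end Splitting

section SpecialLinear

open LieAlgebra LieAlgebra.IsKilling LieModule Module

variable {g : Type*} [LieRing g] [LieAlgebra ℂ g] [FiniteDimensional ℂ g] [IsKilling ℂ g]
  {H : LieSubalgebra ℂ g} [H.IsCartanSubalgebra] {ℓ : (H → ℂ) →ₗ[ℝ] ℝ} {θ : Weight ℂ H g}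
  {E : H} {e f : g}

/-- A Cartan element on which all weights take the values `0` and `±1` has cubic minimal
polynomial. -/
lemma lie_lie_lie_of_apply_cases {a : H}
    (ha : ∀ χ : Weight ℂ H g, χ a = 0 ∨ χ a = 1 ∨ χ a = -1) (x : g) :
    ⁅(a : g), ⁅(a : g), ⁅(a : g), x⁆⁆⁆ = ⁅(a : g), x⁆ := by
  let A : g →ₗ[ℂ] g := LieAlgebra.ad ℂ g a
  have htop := eq_top_of_rootSpace_le (H := H) (LinearMap.ker (A ∘ₗ A ∘ₗ A - A))
    fun χ x hx ↦ by
      have hA : ∀ y, A y = ⁅(a : g), y⁆ := fun y ↦ rfl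
      simp only [LinearMap.mem_ker, LinearMap.sub_apply, LinearMap.comp_apply, hA,
        coe_lie_eq_smul_of_mem_rootSpace hx, lie_smul]
      rcases ha χ with h | h | h <;> simp [h]
  have hx : x ∈ LinearMap.ker (A ∘ₗ A ∘ₗ A - A) := htop ▸ trivial
  exact sub_eq_zero.1 hx

/-- The grading element attached to a root and a splitting element. -/
noncomputable def gradingElement (θ : Weight ℂ H g) (E : H) : H := (2 : ℂ)⁻¹ • (coroot θ + E)

lemma apply_gradingElement (χ : Weight ℂ H g) :
    χ (gradingElement θ E) = 2⁻¹ * (χ (coroot θ) + χ E) := by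
  have h : χ.toLinear ℂ H g (gradingElement θ E) =
    2⁻¹ * (χ.toLinear ℂ H g (coroot θ) + χ.toLinear ℂ H g E) := by
    rw [gradingElement, map_smul, map_add, smul_eq_mul]
  exact h

namespace IsSplitting

lemma apply_cases_neg (hE : IsSplitting θ E) {χ : Weight ℂ H g} (hχ : χ (coroot θ) = -1) :
    χ E = 1 ∨ χ E = -1 := by
  have := hE.apply_cases (-χ) (by simp [hχ])
  simp only [Weight.coe_neg, Pi.neg_apply, neg_eq_iff_eq_neg, neg_neg] at this
  exact this.symm

lemma apply_eq (hE : IsSplitting θ E) (h : IsHighestRoot ℓ θ) (χ : Weight ℂ H g) :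
    χ E = 0 ∨ χ E = 1 ∨ χ E = -1 := by
  rcases h.pairing_cases χ with h₀ | h₁ | h₂ | rfl | rfl
  · exact .inl (hE.apply_orthogonal χ h₀)
  · exact .inr (hE.apply_cases χ h₁)
  · exact .inr (hE.apply_cases_neg h₂)
  · exact .inl hE.apply_self
  · exact .inl (by simp [hE.apply_self])

lemma grading_cases (hE : IsSplitting θ E) (h : IsHighestRoot ℓ θ) (χ : Weight ℂ H g) :
    χ (gradingElement θ E) = 0 ∨ χ = θ ∨ χ = -θ ∨ (χ (coroot θ) = 1 ∧ χ E = 1) ∨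
      (χ (coroot θ) = -1 ∧ χ E = -1) := by
  rcases h.pairing_cases χ with h₀ | h₁ | h₂ | h₃ | h₄
  · exact .inl (by rw [apply_gradingElement, h₀, hE.apply_orthogonal χ h₀]; simp)
  · rcases hE.apply_cases χ h₁ with h' | h'
    · exact .inr (.inr (.inr (.inl ⟨h₁, h'⟩)))
    · exact .inl (by rw [apply_gradingElement, h₁, h']; simp)
  · rcases hE.apply_cases_neg h₂ with h' | h'
    · exact .inl (by rw [apply_gradingElement, h₂, h']; simp)
    · exact .inr (.inr (.inr (.inr ⟨h₂, h'⟩)))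
  · exact .inr (.inl h₃)
  · exact .inr (.inr (.inl h₄))

lemma apply_self_gradingElement (hE : IsSplitting θ E) (h : IsHighestRoot ℓ θ) :
    θ (gradingElement θ E) = 1 := by
  rw [apply_gradingElement, root_apply_coroot h.isNonZero, hE.apply_self]
  norm_num

lemma gradingElement_eq (hE : IsSplitting θ E) (h : IsHighestRoot ℓ θ) (χ : Weight ℂ H g) :
    χ (gradingElement θ E) = 0 ∨ χ (gradingElement θ E) = 1 ∨ χ (gradingElement θ E) = -1 := by
  rcases hE.grading_cases h χ with h₀ | rfl | rfl | ⟨h₁, h₂⟩ | ⟨h₁, h₂⟩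
  · exact .inl h₀
  · exact .inr (.inl (hE.apply_self_gradingElement h))
  · exact .inr (.inr (by rw [Weight.coe_neg, Pi.neg_apply, hE.apply_self_gradingElement h]))
  · exact .inr (.inl (by rw [apply_gradingElement, h₁, h₂]; norm_num))
  · exact .inr (.inr (by rw [apply_gradingElement, h₁, h₂]; norm_num))

lemma gradingElement_eq_of_nonneg (hE : IsSplitting θ E) (h : IsHighestRoot ℓ θ)
    {χ : Weight ℂ H g} (hχ : 0 ≤ ℓ χ) :
    χ (gradingElement θ E) = 0 ∨ χ (gradingElement θ E) = 1 := by
  rcases hE.grading_cases h χ with h₀ | rfl | rfl | ⟨h₁, h₂⟩ | ⟨h₁, h₂⟩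
  · exact .inl h₀
  · exact .inr (hE.apply_self_gradingElement h)
  · rw [Weight.coe_neg, map_neg] at hχ
    linarith [h.pos]
  · exact .inr (by rw [apply_gradingElement, h₁, h₂]; norm_num)
  · have := h.apply_neg_of_apply_coroot_neg (χ := χ) (k := -1) (by simpa using h₁) (by norm_num)
    linarith

lemma lie_lie_lie (hE : IsSplitting θ E) (h : IsHighestRoot ℓ θ) (x : g) :
    ⁅(E : g), ⁅(E : g), ⁅(E : g), x⁆⁆⁆ = ⁅(E : g), x⁆ :=
  lie_lie_lie_of_apply_cases (hE.apply_eq h) x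

lemma lie_lie_lie_gradingElement (hE : IsSplitting θ E) (h : IsHighestRoot ℓ θ) (x : g) :
    ⁅(gradingElement θ E : g), ⁅(gradingElement θ E : g), ⁅(gradingElement θ E : g), x⁆⁆⁆ =
      ⁅(gradingElement θ E : g), x⁆ :=
  lie_lie_lie_of_apply_cases (hE.gradingElement_eq h) x

/-- The degree one part of the grading is the sum of the highest root line and of the space of
elements of weight one for both the coroot and the splitting element. -/
lemma exists_eq_smul_add (hE : IsSplitting θ E) (h : IsHighestRoot ℓ θ)
    (he : e ∈ rootSpace H θ) (he0 : e ≠ 0) {v : g} (hv : ⁅(gradingElement θ E : g), v⁆ = v) :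
    ∃ (c : ℂ) (w : g), v = c • e + w ∧ ⁅(coroot θ : g), w⁆ = w ∧ ⁅(E : g), w⁆ = w := by
  have hω := hE.lie_lie_lie_gradingElement h
  let L : Submodule ℂ g := gradeOne ℂ (coroot θ : g) ⊓ gradeOne ℂ (E : g)
  have htop := eq_top_of_rootSpace_le (H := H) ((ℂ ∙ e ⊔ L).comap
    ((gradeOne ℂ (gradingElement θ E : g)).subtype ∘ₗ gradeOneProj _ hω)) fun χ x hx ↦ by
      rw [Submodule.mem_comap, LinearMap.comp_apply, Submodule.subtype_apply, coe_gradeOneProj]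
      simp only [coe_lie_eq_smul_of_mem_rootSpace hx, lie_smul]
      rcases hE.grading_cases h χ with h₀ | rfl | rfl | ⟨h₁, h₂⟩ | ⟨h₁, h₂⟩
      · simp [h₀]
      · obtain ⟨c, hc⟩ := exists_smul_eq_of_finrank_eq_one
          (finrank_rootSpace_eq_one χ h.isNonZero) (x := ⟨e, he⟩)
          (fun h' ↦ he0 (congrArg Subtype.val h')) ⟨x, hx⟩
        have hc : c • e = x := congrArg Subtype.val hc
        have hxe : x ∈ ℂ ∙ e ⊔ L :=
          Submodule.mem_sup_left (Submodule.mem_span_singleton.2 ⟨c, hc⟩)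
        exact Submodule.smul_mem _ _ (add_mem (Submodule.smul_mem _ _ (Submodule.smul_mem _ _ hxe))
          (Submodule.smul_mem _ _ hxe))
      · rw [Weight.coe_neg, Pi.neg_apply, hE.apply_self_gradingElement h]
        simp
      · have hxL : x ∈ ℂ ∙ e ⊔ L := Submodule.mem_sup_right
          ⟨mem_gradeOne.2 (by rw [coe_lie_eq_smul_of_mem_rootSpace hx, h₁, one_smul]),
            mem_gradeOne.2 (by rw [coe_lie_eq_smul_of_mem_rootSpace hx, h₂, one_smul])⟩
        exact Submodule.smul_mem _ _ (add_mem (Submodule.smul_mem _ _ (Submodule.smul_mem _ _ hxL))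
          (Submodule.smul_mem _ _ hxL))
      · have : χ (gradingElement θ E) = -1 := by rw [apply_gradingElement, h₁, h₂]; norm_num
        simp [this]
  have hvmem : v ∈ (ℂ ∙ e ⊔ L).comap
    ((gradeOne ℂ (gradingElement θ E : g)).subtype ∘ₗ gradeOneProj _ hω) := htop ▸ trivial
  rw [Submodule.mem_comap, LinearMap.comp_apply, Submodule.subtype_apply, coe_gradeOneProj, hv, hv,
    ← two_smul ℂ v, inv_smul_smul₀ two_ne_zero, Submodule.mem_sup] at hvmem
  obtain ⟨y, hy, w, hw, rfl⟩ := hvmem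
  obtain ⟨c, rfl⟩ := Submodule.mem_span_singleton.1 hy
  exact ⟨c, w, rfl, mem_gradeOne.1 hw.1, mem_gradeOne.1 hw.2⟩

end IsSplitting

end SpecialLinear

section Projective

open LieAlgebra LieAlgebra.IsKilling LieModule Module

variable {g : Type*} [LieRing g] [LieAlgebra ℂ g] [FiniteDimensional ℂ g]
  {H : LieSubalgebra ℂ g} [H.IsCartanSubalgebra] {ℓ : (H → ℂ) →ₗ[ℝ] ℝ} {θ : Weight ℂ H g}
  {E : H} {e f : g} {B : LinearMap.BilinForm ℂ g}

namespace IsSplitting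

variable [IsKilling ℂ g]

/-- A lowest root vector acts projectively on the degree one part. -/
lemma lie_lie_eq_of_lowest (hE : IsSplitting θ E) (h : IsHighestRoot ℓ θ)
    (he : e ∈ rootSpace H θ) (he0 : e ≠ 0) (hf : f ∈ rootSpace H (-θ : H → ℂ))
    (hef : ⁅e, f⁆ = coroot θ) (hi : ∀ x y z, B ⁅x, y⁆ z = B x ⁅y, z⁆) (hBfe : B f e = 1)
    {v w : g} (hv : ⁅(gradingElement θ E : g), v⁆ = v) (hw : ⁅(gradingElement θ E : g), w⁆ = w) :
    ⁅⁅v, f⁆, w⁆ = B f v • w + B f w • v := by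
  have hω := hE.lie_lie_lie_gradingElement h
  have hEE := hE.lie_lie_lie h
  have hEe : ⁅(E : g), e⁆ = (0 : ℂ) • e := by
    rw [coe_lie_eq_smul_of_mem_rootSpace he, hE.apply_self]
  have hEf : ⁅(E : g), f⁆ = (0 : ℂ) • f := by
    rw [coe_lie_eq_smul_of_mem_rootSpace hf, Pi.neg_apply, hE.apply_self, neg_zero]
  have hhe : ⁅(coroot θ : g), e⁆ = (2 : ℂ) • e := by
    rw [coe_lie_eq_smul_of_mem_rootSpace he, root_apply_coroot h.isNonZero]
  have hB0 : ∀ u : g, ⁅(E : g), u⁆ = u → B f u = 0 := fun u hu ↦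
    form_eq_zero_of_eigen hi hEf (t := 1) (by rw [hu, one_smul]) (by norm_num)
  have hωe : ⁅(gradingElement θ E : g), e⁆ = e := by
    rw [coe_lie_eq_smul_of_mem_rootSpace he, hE.apply_self_gradingElement h, one_smul]
  obtain ⟨c, v', rfl, hv₁, hv₂⟩ := hE.exists_eq_smul_add h he he0 hv
  obtain ⟨d, w', rfl, hw₁, hw₂⟩ := hE.exists_eq_smul_add h he he0 hw
  have hv'e : ⁅⁅v', f⁆, e⁆ = v' := by
    have hωv : ⁅(gradingElement θ E : g), v'⁆ = v' := by
      rw [lie_add, lie_smul, hωe] at hv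
      exact add_left_cancel hv
    have h₁ : ⁅v', e⁆ = 0 := eq_zero_of_eigen hω (s := (2 : ℂ))
      (lie_lie_eq_smul_of_eigen (s := (1 : ℂ)) (t := 1) (by rw [hωv, one_smul])
        (by rw [hωe, one_smul]) (by norm_num)) (by norm_num)
    have h₂ : ⁅f, e⁆ = -(coroot θ : g) := by rw [← lie_skew, hef]
    rw [lie_lie, h₁, lie_zero, sub_zero, h₂, lie_neg, ← lie_skew, neg_neg, hv₁]
  have hvw : ⁅⁅v', f⁆, w'⁆ = 0 := eq_zero_of_eigen hEE (s := (2 : ℂ))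
    (lie_lie_eq_smul_of_eigen (s := (1 : ℂ)) (t := 1)
      (lie_lie_eq_smul_of_eigen (s := (1 : ℂ)) (by rw [hv₂, one_smul]) hEf (add_zero 1))
      (by rw [hw₂, one_smul]) (by norm_num)) (by norm_num)
  simp only [add_lie, lie_add, smul_lie, lie_smul, hef, hhe, hw₁, hv'e, hvw, map_add, map_smul,
    hBfe, hB0 v' hv₂, hB0 w' hw₂, smul_eq_mul, mul_one, add_zero]
  module

end IsSplitting

/-- The projective action identity propagates from a lowest root vector to everything. -/
lemma IsHighestRoot.lie_lie_eq_of_lowest [IsSimple ℂ g] (h : IsHighestRoot ℓ θ) {ω : g}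
    (hstable : ∀ χ : Weight ℂ H g, 0 ≤ ℓ χ → ∀ a ∈ rootSpace H χ, ∀ v : g, ⁅ω, v⁆ = v →
      ⁅ω, ⁅a, v⁆⁆ = ⁅a, v⁆)
    (hf : f ∈ rootSpace H (-θ : H → ℂ)) (hf0 : f ≠ 0) (hi : ∀ x y z, B ⁅x, y⁆ z = B x ⁅y, z⁆)
    (hT : ∀ v w : g, ⁅ω, v⁆ = v → ⁅ω, w⁆ = w → ⁅⁅v, f⁆, w⁆ = B f v • w + B f w • v)
    (v w x : g) (hv : ⁅ω, v⁆ = v) (hw : ⁅ω, w⁆ = w) :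
    ⁅⁅v, x⁆, w⁆ = B x v • w + B x w • v := by
  let M : Submodule ℂ g :=
    { carrier := {x | ∀ v w : g, ⁅ω, v⁆ = v → ⁅ω, w⁆ = w → ⁅⁅v, x⁆, w⁆ = B x v • w + B x w • v}
      add_mem' := fun {a b} ha hb v w hv hw ↦ by
        rw [lie_add, add_lie, ha v w hv hw, hb v w hv hw, map_add]
        simp only [LinearMap.add_apply]
        module
      zero_mem' := fun v w _ _ ↦ by simp
      smul_mem' := fun c a ha v w hv hw ↦ by
        rw [lie_smul, smul_lie, ha v w hv hw, map_smul]
        simp only [LinearMap.smul_apply, smul_eq_mul]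
        module }
  have htop : M = ⊤ := by
    refine h.eq_top_of_lowest_mem hf hf0 M hT fun χ hχ a ha x hx v w hv hw ↦ ?_
    have hav := hstable χ hχ a ha v hv
    have haw := hstable χ hχ a ha w hw
    have hB : ∀ u, B ⁅a, x⁆ u = -B x ⁅a, u⁆ := fun u ↦ by
      rw [← lie_skew, map_neg, LinearMap.neg_apply, hi]
    have h₁ : ⁅⁅v, ⁅a, x⁆⁆, w⁆ = ⁅a, ⁅⁅v, x⁆, w⁆⁆ - ⁅⁅⁅a, v⁆, x⁆, w⁆ - ⁅⁅v, x⁆, ⁅a, w⁆⁆ := by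
      rw [leibniz_lie a ⁅v, x⁆ w, leibniz_lie a v x, add_lie]
      abel
    rw [h₁, hx v w hv hw, hx _ w hav hw, hx v _ hv haw, hB, hB, lie_add, lie_smul, lie_smul]
    module
  have hx : x ∈ M := htop ▸ trivial
  exact hx v w hv hw

namespace IsSplitting

lemma lie_mem_of_nonneg [IsKilling ℂ g] (hE : IsSplitting θ E) (h : IsHighestRoot ℓ θ)
    {χ : Weight ℂ H g} (hχ : 0 ≤ ℓ χ) {a : g} (ha : a ∈ rootSpace H χ) {v : g}
    (hv : ⁅(gradingElement θ E : g), v⁆ = v) : ⁅(gradingElement θ E : g), ⁅a, v⁆⁆ = ⁅a, v⁆ := by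
  have hωa := coe_lie_eq_smul_of_mem_rootSpace ha (gradingElement θ E)
  have hv' : ⁅(gradingElement θ E : g), v⁆ = (1 : ℂ) • v := by rw [hv, one_smul]
  rcases hE.gradingElement_eq_of_nonneg h hχ with h₀ | h₁
  · rw [h₀] at hωa
    rw [lie_lie_eq_smul_of_eigen hωa hv' (zero_add 1), one_smul]
  · rw [h₁] at hωa
    rw [eq_zero_of_eigen (hE.lie_lie_lie_gradingElement h)
      (lie_lie_eq_smul_of_eigen hωa hv' one_add_one_eq_two) (by norm_num), lie_zero]

lemma one_lt_finrank_gradeOne [IsKilling ℂ g] (hE : IsSplitting θ E) (h : IsHighestRoot ℓ θ)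
    {γ : Weight ℂ H g} (hγ : γ (coroot θ) = 1) (hγE : γ E = 1) :
    1 < finrank ℂ (gradeOne ℂ (gradingElement θ E : g)) := by
  obtain ⟨e, he, he0⟩ := θ.exists_ne_zero
  obtain ⟨x, hx, hx0⟩ := γ.exists_ne_zero
  have hωe : e ∈ gradeOne ℂ (gradingElement θ E : g) := mem_gradeOne.2 <| by
    rw [coe_lie_eq_smul_of_mem_rootSpace he, hE.apply_self_gradingElement h, one_smul]
  have hωx : x ∈ gradeOne ℂ (gradingElement θ E : g) := mem_gradeOne.2 <| by
    rw [coe_lie_eq_smul_of_mem_rootSpace hx, apply_gradingElement, hγ, hγE, one_add_one_eq_two,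
      inv_mul_cancel₀ two_ne_zero, one_smul]
  by_contra! hle
  obtain ⟨c, hc⟩ := (finrank_le_one_iff.1 hle)
  obtain ⟨r, hr⟩ := hc ⟨e, hωe⟩
  obtain ⟨s, hs⟩ := hc ⟨x, hωx⟩
  have hr : r • (c : g) = e := congrArg Subtype.val hr
  have hs : s • (c : g) = x := congrArg Subtype.val hs
  have h₁ := coe_lie_eq_smul_of_mem_rootSpace he E
  have h₂ := coe_lie_eq_smul_of_mem_rootSpace hx E
  rw [hE.apply_self, zero_smul, ← hr, lie_smul, smul_eq_zero] at h₁
  have hr0 : r ≠ 0 := fun h' ↦ he0 (by rw [← hr, h', zero_smul])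
  rw [hγE, one_smul, ← hs, lie_smul, h₁.resolve_left hr0, smul_zero, hs] at h₂
  exact hx0 h₂.symm

/-- A simple complex Lie algebra with a splitting element for its highest root is special
linear. -/
theorem exists_nonempty_lieEquiv_sl [IsSimple ℂ g] (hE : IsSplitting θ E) (h : IsHighestRoot ℓ θ)
    {γ : Weight ℂ H g} (hγ : γ (coroot θ) = 1) (hγE : γ E = 1) :
    ∃ n : ℕ, 3 ≤ n ∧ Nonempty (g ≃ₗ⁅ℂ⁆ SpecialLinear.sl (Fin n) ℂ) := by
  have hrank := hE.one_lt_finrank_gradeOne h hγ hγE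
  refine ⟨_, Nat.succ_le_succ hrank, ?_⟩
  obtain ⟨t, e, f, ht, he, hf⟩ := exists_isSl2Triple_of_weight_isNonZero h.isNonZero
  obtain rfl := ht.h_eq_coroot h.isNonZero he hf
  have hκ : killingForm ℂ g e f ≠ 0 := fun h0 ↦ ht.h_ne_zero <| by
    rw [← ht.lie_e_f, lie_eq_killingForm_smul_of_mem_rootSpace_of_mem_rootSpace_neg he hf, h0,
      zero_smul]
  let B : LinearMap.BilinForm ℂ g := (killingForm ℂ g e f)⁻¹ • killingForm ℂ g
  have hs : ∀ x y, B x y = B y x := fun x y ↦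
    congrArg ((killingForm ℂ g e f)⁻¹ * ·) (traceForm_comm ℂ g g x y)
  have hi : ∀ x y z, B ⁅x, y⁆ z = B x ⁅y, z⁆ := fun x y z ↦
    congrArg ((killingForm ℂ g e f)⁻¹ * ·) (traceForm_apply_lie_apply ℂ g g x y z)
  have hBfe : B f e = 1 := by
    rw [hs]
    exact inv_mul_cancel₀ hκ
  have hB : B.Nondegenerate := by
    have hκg := killingForm_nondegenerate ℂ g
    exact ⟨fun x hx ↦ hκg.1 x fun y ↦ (mul_eq_zero.1 (hx y)).resolve_left (inv_ne_zero hκ),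
      fun y hy ↦ hκg.2 y fun x ↦ (mul_eq_zero.1 (hy x)).resolve_left (inv_ne_zero hκ)⟩
  refine nonempty_lieEquiv_sl_of_projective (hE.lie_lie_lie_gradingElement h) hs hi hB
    (fun v w x hv hw ↦ h.lie_lie_eq_of_lowest
      (fun χ hχ a ha v hv ↦ hE.lie_mem_of_nonneg h hχ ha hv) hf ht.f_ne_zero hi
      (fun v w hv hw ↦ hE.lie_lie_eq_of_lowest h he ht.e_ne_zero hf ht.lie_e_f hi hBfe hv hw)
      v w x hv hw) fun hbot ↦ ?_
  rw [hbot, finrank_bot] at hrank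
  exact absurd hrank (by norm_num)

end IsSplitting

end Projective

section Bracket

open LieAlgebra LieAlgebra.IsKilling LieModule Module

variable {g : Type*} [LieRing g] [LieAlgebra ℂ g]

/-- On a simple complex Lie algebra other than `sl_n` with `n ≥ 3`, every equivariant bilinear map
is a multiple of the bracket. -/
theorem exists_eq_smul_lie_of_equivariant [IsSimple ℂ g] [FiniteDimensional ℂ g]
    (hnot : ∀ n : ℕ, 3 ≤ n → IsEmpty (g ≃ₗ⁅ℂ⁆ SpecialLinear.sl (Fin n) ℂ))
    (F : g →ₗ[ℂ] g →ₗ[ℂ] g) (hF : ∀ x y z : g, F ⁅x, y⁆ z + F y ⁅x, z⁆ = ⁅x, F y z⁆) :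
    ∃ c : ℂ, ∀ y z, F y z = c • ⁅y, z⁆ := by
  have : Nontrivial g := by
    by_contra hnt
    rw [not_nontrivial_iff_subsingleton] at hnt
    exact IsSimple.non_abelian (R := ℂ) (L := g) ⟨fun _ _ ↦ Subsingleton.elim _ _⟩
  obtain ⟨x₀, hx₀⟩ := exists_isCartanSubalgebra_engel ℂ g
  obtain ⟨ℓ, θ, h⟩ := exists_isHighestRoot (LieSubalgebra.engel ℂ x₀)
  obtain ⟨t, e, f, ht, he, hf⟩ := exists_isSl2Triple_of_weight_isNonZero h.isNonZero
  obtain rfl := ht.h_eq_coroot h.isNonZero he hf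
  obtain ⟨A, hA, horth⟩ := h.exists_apply_eq_coe he hf hF
  let c : ℂ := 2⁻¹ * θ A
  let F' : g →ₗ[ℂ] g →ₗ[ℂ] g := F - c • TensorProduct.curry (toModuleHom ℂ g g : g ⊗[ℂ] g →ₗ[ℂ] g)
  have hF'_apply : ∀ y z, F' y z = F y z - c • ⁅y, z⁆ := fun y z ↦ rfl
  have hF' : ∀ x y z : g, F' ⁅x, y⁆ z + F' y ⁅x, z⁆ = ⁅x, F' y z⁆ := fun x y z ↦ by
    simp only [hF'_apply, lie_sub, lie_smul, ← hF, leibniz_lie x y z, smul_add]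
    abel
  obtain ⟨A', hA', horth'⟩ := h.exists_apply_eq_coe he hf hF'
  have hA'A : A' = A - c • coroot θ := Subtype.ext (by
    rw [← hA', hF'_apply, hA, ht.lie_e_f]
    rfl)
  have hθA' : θ A' = 0 := by
    have h₁ : θ.toLinear ℂ _ g A' = θ.toLinear ℂ _ g A - c * θ.toLinear ℂ _ g (coroot θ) := by
      rw [hA'A, map_sub, map_smul, smul_eq_mul]
    have h₂ : θ A' = θ A - c * θ (coroot θ) := h₁
    rw [h₂, root_apply_coroot h.isNonZero]
    ring
  by_cases hA'0 : A' = 0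
  · have hzero := h.eq_zero_of_apply_eq_zero he ht.e_ne_zero hf ht.f_ne_zero hF'
      (by rw [hA', hA'0, ZeroMemClass.coe_zero])
    refine ⟨c, fun y z ↦ sub_eq_zero.1 ?_⟩
    rw [← hF'_apply, hzero, LinearMap.zero_apply, LinearMap.zero_apply]
  · obtain ⟨E, hE, γ, hγ, hγE⟩ := h.exists_isSplitting hA'0 hθA' horth'
    obtain ⟨n, hn, hiso⟩ := hE.exists_nonempty_lieEquiv_sl h hγ hγE
    exact absurd hiso (not_nonempty_iff.2 (hnot n hn))

/-- The Lie bracket as an element of `homg g`. -/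
noncomputable def bracketHom (g : Type*) [LieRing g] [LieAlgebra ℂ g] : homg g :=
  ⟨toModuleHom ℂ g g, fun x y z ↦ by
    simp⟩

lemma bracketHom_tmul (y z : g) : (bracketHom g : g ⊗[ℂ] g →ₗ[ℂ] g) (y ⊗ₜ z) = ⁅y, z⁆ :=
  rfl

lemma bracketHom_ne_zero [IsSimple ℂ g] : bracketHom g ≠ 0 := fun h0 ↦
  IsSimple.non_abelian (R := ℂ) (L := g) ⟨fun y z ↦ by
    rw [← bracketHom_tmul, h0, ZeroMemClass.coe_zero, LinearMap.zero_apply]⟩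

end Bracket

/-- If `g` is a simple complex Lie algebra not isomorphic to `sl_n(ℂ)`
for any `n ≥ 3`, then the space of `g`-module morphisms `g ⊗ g → g` is
one-dimensional, spanned by the Lie bracket. -/
theorem finrank_homg_eq_one_of_not_sl
    (g : Type) [LieRing g] [LieAlgebra ℂ g] [LieAlgebra.IsSimple ℂ g]
    [FiniteDimensional ℂ g]
    (hnot : ∀ n : ℕ, 3 ≤ n →
      IsEmpty (g ≃ₗ⁅ℂ⁆ (LieAlgebra.SpecialLinear.sl (Fin n) ℂ))) :
    Module.finrank ℂ (homg g) = 1 ∧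
      ∀ f ∈ homg g, ∃ c : ℂ, ∀ y z : g, f (y ⊗ₜ[ℂ] z) = c • ⁅y, z⁆ := by
  have key : ∀ f ∈ homg g, ∃ c : ℂ, ∀ y z : g, f (y ⊗ₜ[ℂ] z) = c • ⁅y, z⁆ := fun f hf ↦
    exists_eq_smul_lie_of_equivariant hnot (TensorProduct.curry f) fun x y z ↦ by
      simpa using hf x y z
  refine ⟨finrank_eq_one (bracketHom g) bracketHom_ne_zero fun f ↦ ?_, key⟩
  obtain ⟨c, hc⟩ := key f f.2
  exact ⟨c, Subtype.ext (TensorProduct.ext' fun y z ↦ (hc y z).symm)⟩
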